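/- Let 𝕂 be a field, n ≥ 2, N = n(n−1)/2, and z = (z_1,…,z_N) ∈ (𝕂ˣ)^N. Set u := x_{−i_1}(z_1)⋯x_{−i_N}(z_N) where (i_1,…,i_N) = 𝐢₀, assume (w̄₀·uᵀ)⁻¹ = L·D·U with L lower triangular with unit diagonal, D invertible diagonal, U upper triangular with unit diagonal, and set u₁ := (w̄₀·U⁻¹·w̄₀⁻¹)ᵀ. Then u₁ = x_{i′_1}(p_1)·x_{i′_2}(p_2)⋯x_{i′_N}(p_N), where (i′_1,…,i′_N) = 𝐢′₀ and, for 1 ≤ k ≤ n−1 and 1 ≤ a ≤ n−k, p_{s_k+a} = z_{1+s_a} if k = 1 and p_{s_k+a} = z_{k+s_a} / z_{k−1+s_{a+1}} if k ≥ 2. -/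

import Mathlib

open Matrix

/-- `yMat n 𝕂 i z` is the n×n identity matrix except entry (i+1, i) (1-based) equals `z`. -/
def yMat (n : ℕ) (𝕂 : Type*) [Field 𝕂] (i : ℕ) (z : 𝕂) :
    Matrix (Fin n) (Fin n) 𝕂 :=
  fun a b => if a = b then 1 else if (a : ℕ) = i ∧ (b : ℕ) + 1 = i then z else 0

/-- `xMat n 𝕂 i z` is the n×n identity matrix except entry (i, i+1) (1-based) equals `z`. -/
def xMat (n : ℕ) (𝕂 : Type*) [Field 𝕂] (i : ℕ) (z : 𝕂) :
    Matrix (Fin n) (Fin n) 𝕂 :=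
  fun a b => if a = b then 1 else if (a : ℕ) + 1 = i ∧ (b : ℕ) = i then z else 0

/-- `xNegMat n 𝕂 i z` is the identity except the 2×2 block in rows/cols i, i+1 (1-based)
equals [[z⁻¹, 0], [1, z]]. -/
noncomputable def xNegMat (n : ℕ) (𝕂 : Type*) [Field 𝕂] (i : ℕ) (z : 𝕂) :
    Matrix (Fin n) (Fin n) 𝕂 :=
  fun a b =>
    if (a : ℕ) + 1 = i ∧ (b : ℕ) + 1 = i then z⁻¹
    else if (a : ℕ) = i ∧ (b : ℕ) = i then z
    else if (a : ℕ) = i ∧ (b : ℕ) + 1 = i then 1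
    else if a = b then 1 else 0

/-- The matrix w̄₀ with (i, n+1−i) entry (−1)^(n−i) (1-based) and other entries 0. -/
def w0bar (n : ℕ) (𝕂 : Type*) [Field 𝕂] : Matrix (Fin n) (Fin n) 𝕂 :=
  fun a b => if (a : ℕ) + (b : ℕ) = n - 1 then (-1 : 𝕂) ^ (n - 1 - (a : ℕ)) else 0

/-- s_k = Σ_{j=1}^{k−1} (n−j). -/
def sIdx (n k : ℕ) : ℕ := ∑ j ∈ Finset.Icc 1 (k - 1), (n - j)

/-- The word 𝐢₀ = (1,2,…,n−1, 1,2,…,n−2, …, 1,2, 1). -/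
def wordI0 (n : ℕ) : List ℕ :=
  (List.range (n - 1)).flatMap (fun k => (List.range (n - 1 - k)).map (· + 1))

/-- The word 𝐢′₀ = (n−1,…,1, n−1,…,2, …, n−1,n−2, n−1). -/
def wordI0' (n : ℕ) : List ℕ :=
  (List.range (n - 1)).flatMap (fun k => (List.range (n - 1 - k)).map (fun a => n - 1 - a))

/-- The simple reflection s_i = (i, i+1) (1-based) as a permutation of `Fin n`. -/
def sPerm (n i : ℕ) : Equiv.Perm (Fin n) :=
  if h : 1 ≤ i ∧ i < n then Equiv.swap ⟨i - 1, by omega⟩ ⟨i, h.2⟩ else 1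

/-- The longest element of S_n, k ↦ n+1−k (1-based). -/
def w0Perm (n : ℕ) : Equiv.Perm (Fin n) where
  toFun a := ⟨n - 1 - (a : ℕ), by have := a.isLt; omega⟩
  invFun a := ⟨n - 1 - (a : ℕ), by have := a.isLt; omega⟩
  left_inv a := by
    have := a.isLt
    apply Fin.ext
    show n - 1 - (n - 1 - (a : ℕ)) = (a : ℕ)
    omega
  right_inv a := by
    have := a.isLt
    apply Fin.ext
    show n - 1 - (n - 1 - (a : ℕ)) = (a : ℕ)
    omega

/-- Apply a permutation of `Fin n` to a 1-based label in {1, …, n}. -/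
def permApp {n : ℕ} (σ : Equiv.Perm (Fin n)) (x : ℕ) : ℕ :=
  if h : 1 ≤ x ∧ x ≤ n then ((σ ⟨x - 1, by omega⟩ : Fin n) : ℕ) + 1 else x


section Prelim

variable {𝕂 : Type*} [Field 𝕂] {n : ℕ}

/-- The standard basis vector `e_k` (1-based); it is zero unless `1 ≤ k ≤ n`. -/
def stdVec (n : ℕ) (𝕂 : Type*) [Field 𝕂] (k : ℕ) : Fin n → 𝕂 :=
  fun a => if (a : ℕ) + 1 = k then 1 else 0

theorem mulVec_stdVec (A : Matrix (Fin n) (Fin n) 𝕂) (b : Fin n) :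
    A *ᵥ stdVec n 𝕂 (b + 1) = fun a => A a b := by
  ext a
  simp [stdVec, mulVec, dotProduct, Fin.val_inj]

theorem stdVec_eq_zero {k : ℕ} (hk : k = 0 ∨ n < k) : stdVec n 𝕂 k = 0 := by
  ext a
  have := a.isLt
  have : (a : ℕ) + 1 ≠ k := by omega
  simp [stdVec, this]

theorem mulVec_stdVec_eq {A : Matrix (Fin n) (Fin n) 𝕂} {k : ℕ} {v : Fin n → 𝕂}
    (h : ∀ b : Fin n, (b : ℕ) + 1 = k → ∀ a, A a b = v a) (h0 : k = 0 ∨ n < k → v = 0) :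
    A *ᵥ stdVec n 𝕂 k = v := by
  by_cases hk : k = 0 ∨ n < k
  · rw [stdVec_eq_zero hk, h0 hk, mulVec_zero]
  · push Not at hk
    obtain ⟨b, rfl⟩ : ∃ b : Fin n, k = b + 1 := ⟨⟨k - 1, by omega⟩, by simp; omega⟩
    rw [mulVec_stdVec]
    ext a
    exact h b rfl a

theorem xNegMat_mulVec_left {i : ℕ} (hi : 1 ≤ i) (z : 𝕂) :
    xNegMat n 𝕂 i z *ᵥ stdVec n 𝕂 i = z⁻¹ • stdVec n 𝕂 i + stdVec n 𝕂 (i + 1) := by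
  apply mulVec_stdVec_eq
  · intro b hb a
    simp only [xNegMat, stdVec, Pi.add_apply, Pi.smul_apply, smul_eq_mul, Fin.ext_iff]
    split_ifs <;> first | omega | simp
  · intro h
    rw [stdVec_eq_zero h, stdVec_eq_zero (by omega)]
    simp

theorem xNegMat_mulVec_right {i : ℕ} (z : 𝕂) :
    xNegMat n 𝕂 i z *ᵥ stdVec n 𝕂 (i + 1) = z • stdVec n 𝕂 (i + 1) := by
  apply mulVec_stdVec_eq
  · intro b hb a
    simp only [xNegMat, stdVec, Pi.smul_apply, smul_eq_mul, Fin.ext_iff]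
    split_ifs <;> first | omega | simp
  · intro h
    rw [stdVec_eq_zero h]
    simp

theorem xNegMat_mulVec_of_ne {i l : ℕ} (z : 𝕂) (h₁ : l ≠ i) (h₂ : l ≠ i + 1) :
    xNegMat n 𝕂 i z *ᵥ stdVec n 𝕂 l = stdVec n 𝕂 l := by
  apply mulVec_stdVec_eq
  · intro b hb a
    simp only [xNegMat, stdVec, Fin.ext_iff]
    split_ifs <;> first | omega | simp
  · exact stdVec_eq_zero

theorem xMat_mulVec_succ {i : ℕ} (hi : i < n) (c : 𝕂) :
    xMat n 𝕂 i c *ᵥ stdVec n 𝕂 (i + 1) = stdVec n 𝕂 (i + 1) + c • stdVec n 𝕂 i := by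
  apply mulVec_stdVec_eq
  · intro b hb a
    simp only [xMat, stdVec, Pi.add_apply, Pi.smul_apply, smul_eq_mul, Fin.ext_iff]
    split_ifs <;> first | omega | simp
  · omega

theorem xMat_mulVec_of_ne {i l : ℕ} (c : 𝕂) (h : l ≠ i + 1) :
    xMat n 𝕂 i c *ᵥ stdVec n 𝕂 l = stdVec n 𝕂 l := by
  apply mulVec_stdVec_eq
  · intro b hb a
    simp only [xMat, stdVec, Fin.ext_iff]
    split_ifs <;> first | omega | simp
  · exact stdVec_eq_zero

theorem ext_of_mulVec_stdVec {A B : Matrix (Fin n) (Fin n) 𝕂}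
    (h : ∀ b : Fin n, A *ᵥ stdVec n 𝕂 (b + 1) = B *ᵥ stdVec n 𝕂 (b + 1)) : A = B := by
  ext a b
  have := congrFun (h b) a
  rwa [mulVec_stdVec, mulVec_stdVec] at this

theorem xMat_inv {i : ℕ} (hi : i < n) (c : 𝕂) : (xMat n 𝕂 i c)⁻¹ = xMat n 𝕂 i (-c) := by
  apply inv_eq_right_inv
  apply ext_of_mulVec_stdVec
  intro b
  rw [one_mulVec, ← mulVec_mulVec]
  by_cases hb : (b : ℕ) + 1 = i + 1
  · rw [hb, xMat_mulVec_succ hi, mulVec_add, mulVec_smul, xMat_mulVec_succ hi,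
      xMat_mulVec_of_ne c (by omega)]
    simp
  · rw [xMat_mulVec_of_ne _ hb, xMat_mulVec_of_ne _ hb]

/-- The vector `w` is supported on its first `s` coordinates. -/
def SuppLE (s : ℕ) (w : Fin n → 𝕂) : Prop := ∀ a : Fin n, s ≤ a → w a = 0

theorem suppLE_stdVec {k s : ℕ} (h : k ≤ s) : SuppLE s (stdVec n 𝕂 k) := by
  intro a ha
  simp only [stdVec]
  split_ifs <;> first | omega | rfl

/-- Upper triangular matrices with unit diagonal. -/
def IsUpperUni (A : Matrix (Fin n) (Fin n) 𝕂) : Prop :=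
  A.BlockTriangular id ∧ ∀ a, A a a = 1

theorem IsUpperUni.mul {A B : Matrix (Fin n) (Fin n) 𝕂} (hA : IsUpperUni A)
    (hB : IsUpperUni B) : IsUpperUni (A * B) := by
  refine ⟨hA.1.mul hB.1, fun a => ?_⟩
  rw [mul_apply, Finset.sum_eq_single a, hA.2, hB.2, one_mul]
  · intro c _ hc
    rcases lt_or_gt_of_ne hc with h | h
    · rw [hA.1 h, zero_mul]
    · rw [hB.1 h, mul_zero]
  · simp

theorem IsUpperUni.one : IsUpperUni (1 : Matrix (Fin n) (Fin n) 𝕂) :=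
  ⟨blockTriangular_one, fun a => one_apply_eq a⟩

theorem isUpperUni_xMat (i : ℕ) (c : 𝕂) : IsUpperUni (xMat n 𝕂 i c) := by
  constructor
  · intro a b hab
    simp only [id, Fin.lt_def] at hab
    simp only [xMat, Fin.ext_iff]
    split_ifs <;> first | omega | rfl
  · intro a
    simp [xMat]

theorem IsUpperUni.list_prod {l : List (Matrix (Fin n) (Fin n) 𝕂)}
    (h : ∀ A ∈ l, IsUpperUni A) : IsUpperUni l.prod := by
  induction l with
  | nil => exact IsUpperUni.one
  | cons A l ih =>
    rw [List.prod_cons]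
    exact (h A (by simp)).mul (ih fun B hB => h B (by simp [hB]))

theorem IsUpperUni.det {A : Matrix (Fin n) (Fin n) 𝕂} (hA : IsUpperUni A) : A.det = 1 := by
  rw [det_of_isUpperTriangular hA.1]
  simp [hA.2]

theorem IsUpperUni.suppLE_inv {A : Matrix (Fin n) (Fin n) 𝕂} (hA : IsUpperUni A) {s : ℕ}
    {w : Fin n → 𝕂} (hw : SuppLE s w) : SuppLE s (A⁻¹ *ᵥ w) := by
  have := invertibleOfIsUnitDet A (by simp [hA.det])
  have hT : A⁻¹.BlockTriangular id := blockTriangular_inv_of_blockTriangular hA.1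
  intro a ha
  rw [mulVec, dotProduct]
  refine Finset.sum_eq_zero fun b _ => ?_
  by_cases hb : b < a
  · rw [hT hb, zero_mul]
  · rw [hw b (by rw [Fin.lt_def] at hb; omega), mul_zero]

theorem IsUpperUni.eq_one_of_mul_eq_one {Y Z : Matrix (Fin n) (Fin n) 𝕂}
    (hZ : IsUpperUni Z) (hY : ∀ a b : Fin n, a < b → Y a b = 0) (h : Y * Z = 1) : Z = 1 := by
  have := invertibleOfIsUnitDet Z (by simp [hZ.det])
  have hT : Y.BlockTriangular id := by
    rw [← inv_eq_left_inv h]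
    exact blockTriangular_inv_of_blockTriangular hZ.1
  have hY1 : Y = 1 := by
    ext a b
    rcases lt_trichotomy a b with hab | rfl | hab
    · rw [hY a b hab, one_apply_ne hab.ne]
    · have h1 := congrFun (congrFun h a) a
      rw [mul_apply, Finset.sum_eq_single a, hZ.2, mul_one] at h1
      · exact h1
      · intro c _ hc
        rcases lt_or_gt_of_ne hc with h | h
        · rw [hT h, zero_mul]
        · rw [hY _ _ h, zero_mul]
      · simp
    · rw [hT hab, one_apply_ne hab.ne']
  rwa [hY1, one_mul] at h

end Prelim

section Factor

variable {𝕂 : Type*} [Field 𝕂] (n : ℕ)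

/-- The product `x_{-1}(t 1) ⋯ x_{-q}(t q)`. -/
noncomputable def negRow (t : ℕ → 𝕂) (q : ℕ) : Matrix (Fin n) (Fin n) 𝕂 :=
  ((List.range q).map fun j => xNegMat n 𝕂 (j + 1) (t (j + 1))).prod

theorem negRow_succ (t : ℕ → 𝕂) (q : ℕ) :
    negRow n t (q + 1) = negRow n t q * xNegMat n 𝕂 (q + 1) (t (q + 1)) := by
  simp [negRow, List.range_succ]

theorem negRow_mulVec_of_lt (t : ℕ → 𝕂) {q l : ℕ} (h : q + 1 < l) :
    negRow n t q *ᵥ stdVec n 𝕂 l = stdVec n 𝕂 l := by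
  induction q with
  | zero => simp [negRow]
  | succ q ih =>
    rw [negRow_succ, ← mulVec_mulVec, xNegMat_mulVec_of_ne _ (by omega) (by omega),
      ih (by omega)]

theorem negRow_mulVec_last (t : ℕ → 𝕂) (ht : t 0 = 1) (q : ℕ) :
    negRow n t q *ᵥ stdVec n 𝕂 (q + 1) = t q • stdVec n 𝕂 (q + 1) := by
  cases q with
  | zero => simp [negRow, ht]
  | succ q =>
    rw [negRow_succ, ← mulVec_mulVec, xNegMat_mulVec_right, mulVec_smul,
      negRow_mulVec_of_lt n t (by omega)]

theorem negRow_mulVec (t : ℕ → 𝕂) (ht : t 0 = 1) {q l : ℕ} (h : l + 1 ≤ q) :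
    negRow n t q *ᵥ stdVec n 𝕂 (l + 1) =
      (t l / t (l + 1)) • stdVec n 𝕂 (l + 1) + stdVec n 𝕂 (l + 2) := by
  induction q, h using Nat.le_induction with
  | base =>
    rw [negRow_succ, ← mulVec_mulVec, xNegMat_mulVec_left (by omega), mulVec_add, mulVec_smul,
      negRow_mulVec_last n t ht, negRow_mulVec_of_lt n t (by omega), smul_smul, div_eq_inv_mul]
  | succ q hq ih =>
    rw [negRow_succ, ← mulVec_mulVec, xNegMat_mulVec_of_ne _ (by omega) (by omega), ih]

theorem negRow_apply_eq_zero (t : ℕ → 𝕂) (ht : t 0 = 1) (q : ℕ) {a b : Fin n}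
    (h : (b : ℕ) + 1 < a) : negRow n t q a b = 0 := by
  have key : (negRow n t q *ᵥ stdVec n 𝕂 (b + 1)) a = 0 := by
    have h1 : stdVec n 𝕂 ((b : ℕ) + 1) a = 0 := by
      simp only [stdVec]; split_ifs <;> first | omega | rfl
    have h2 : stdVec n 𝕂 ((b : ℕ) + 2) a = 0 := by
      simp only [stdVec]; split_ifs <;> first | omega | rfl
    rcases lt_trichotomy q b with hq | rfl | hq
    · rw [negRow_mulVec_of_lt n t (by omega), h1]
    · rw [negRow_mulVec_last n t ht, Pi.smul_apply, h1, smul_zero]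
    · rw [negRow_mulVec n t ht hq, Pi.add_apply, Pi.smul_apply, h1, h2, smul_zero, add_zero]
  rwa [mulVec_stdVec] at key

theorem suppLE_negRow_mulVec (t : ℕ → 𝕂) (ht : t 0 = 1) (q : ℕ) {s : ℕ} {w : Fin n → 𝕂}
    (hw : SuppLE s w) : SuppLE (s + 1) (negRow n t q *ᵥ w) := by
  intro a ha
  rw [mulVec, dotProduct]
  refine Finset.sum_eq_zero fun b _ => ?_
  by_cases hb : s ≤ b
  · rw [hw b hb, mul_zero]
  · rw [negRow_apply_eq_zero n t ht q (by omega), zero_mul]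

/-- The product of the rows `x_{-1}(τ k 1) ⋯ x_{-(k-1)}(τ k (k-1))` for `k = m, m - 1, …, 2`. -/
noncomputable def negProd (τ : ℕ → ℕ → 𝕂) (m : ℕ) : Matrix (Fin n) (Fin n) 𝕂 :=
  ((List.range (m - 1)).map fun k => negRow n (τ (m - k)) (m - k - 1)).prod

theorem negProd_succ (τ : ℕ → ℕ → 𝕂) {m : ℕ} (hm : 1 ≤ m) :
    negProd n τ (m + 1) = negRow n (τ (m + 1)) m * negProd n τ m := by
  obtain ⟨m, rfl⟩ : ∃ k, m = k + 1 := ⟨m - 1, by omega⟩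
  simp [negProd, List.range_succ_eq_map, Function.comp_def]

theorem negProd_mulVec_of_lt (τ : ℕ → ℕ → 𝕂) {m l : ℕ} (hm : 1 ≤ m) (h : m < l) :
    negProd n τ m *ᵥ stdVec n 𝕂 l = stdVec n 𝕂 l := by
  induction m, hm using Nat.le_induction with
  | base => simp [negProd]
  | succ m hm ih =>
    rw [negProd_succ n τ hm, ← mulVec_mulVec, ih (by omega), negRow_mulVec_of_lt n _ (by omega)]

/-- The product `x_{m-1}(d (m-1) k) ⋯ x_k(d k k)`. -/
noncomputable def posRow (d : ℕ → ℕ → 𝕂) (k m : ℕ) : Matrix (Fin n) (Fin n) 𝕂 :=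
  ((List.range (m - k)).map fun a => xMat n 𝕂 (m - 1 - a) (d (m - 1 - a) k)).prod

theorem posRow_succ (d : ℕ → ℕ → 𝕂) {k m : ℕ} (h : k ≤ m) :
    posRow n d k (m + 1) = xMat n 𝕂 m (d m k) * posRow n d k m := by
  rw [posRow, posRow, Nat.succ_sub h, List.range_succ_eq_map]
  simp [Function.comp_def, Nat.sub_sub, Nat.add_comm]

theorem posRow_of_le (d : ℕ → ℕ → 𝕂) {k m : ℕ} (h : m ≤ k) : posRow n d k m = 1 := by
  simp [posRow, Nat.sub_eq_zero_of_le h]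

theorem isUpperUni_posRow (d : ℕ → ℕ → 𝕂) (k m : ℕ) : IsUpperUni (posRow n d k m) := by
  apply IsUpperUni.list_prod
  simp only [List.mem_map]
  rintro _ ⟨a, -, rfl⟩
  exact isUpperUni_xMat _ _

theorem posRow_inv_succ (d : ℕ → ℕ → 𝕂) {k m : ℕ} (h : k ≤ m) (hm : m < n) :
    (posRow n d k (m + 1))⁻¹ = (posRow n d k m)⁻¹ * xMat n 𝕂 m (-d m k) := by
  rw [posRow_succ n d h, Matrix.mul_inv_rev, xMat_inv hm]

theorem posRow_inv_mulVec_of_lt (d : ℕ → ℕ → 𝕂) (k : ℕ) {m l : ℕ} (hm : m ≤ n) (h : m < l) :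
    (posRow n d k m)⁻¹ *ᵥ stdVec n 𝕂 l = stdVec n 𝕂 l := by
  induction m with
  | zero => simp [posRow]
  | succ m ih =>
    by_cases hk : k ≤ m
    · rw [posRow_inv_succ n d hk (by omega), ← mulVec_mulVec, xMat_mulVec_of_ne _ (by omega),
        ih (by omega) (by omega)]
    · rw [posRow_of_le n d (by omega), inv_one, one_mulVec]

/-- The product of the rows `x_{m-1}(d (m-1) l) ⋯ x_l(d l l)` for `l = k, …, m - 1`. -/
noncomputable def posProd (d : ℕ → ℕ → 𝕂) (k m : ℕ) : Matrix (Fin n) (Fin n) 𝕂 :=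
  ((List.range (m - k)).map fun a => posRow n d (k + a) m).prod

theorem posProd_eq_mul (d : ℕ → ℕ → 𝕂) (k m : ℕ) :
    posProd n d k m = posRow n d k m * posProd n d (k + 1) m := by
  by_cases h : m ≤ k
  · simp [posProd, Nat.sub_eq_zero_of_le h, Nat.sub_eq_zero_of_le (h.trans k.le_succ),
      posRow_of_le n d h]
  · obtain ⟨j, rfl⟩ : ∃ j, m = k + j + 1 := ⟨m - k - 1, by omega⟩
    have h1 : k + j + 1 - k = j + 1 := by omega
    have h2 : k + j + 1 - (k + 1) = j := by omega
    rw [posProd, posProd, h1, h2, List.range_succ_eq_map]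
    simp [Function.comp_def, Nat.add_assoc, Nat.add_comm 1]

theorem posProd_of_le (d : ℕ → ℕ → 𝕂) {k m : ℕ} (h : m ≤ k) : posProd n d k m = 1 := by
  simp [posProd, Nat.sub_eq_zero_of_le h]

theorem isUpperUni_posProd (d : ℕ → ℕ → 𝕂) (k m : ℕ) : IsUpperUni (posProd n d k m) := by
  apply IsUpperUni.list_prod
  simp only [List.mem_map]
  rintro _ ⟨a, -, rfl⟩
  exact isUpperUni_posRow _ _ _ _

theorem posProd_inv (d : ℕ → ℕ → 𝕂) (k m : ℕ) :
    (posProd n d k m)⁻¹ = (posProd n d (k + 1) m)⁻¹ * (posRow n d k m)⁻¹ := by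
  rw [posProd_eq_mul, Matrix.mul_inv_rev]

theorem xMat_mulVec_of_suppLE {m : ℕ} (c : 𝕂) {w : Fin n → 𝕂} (hw : SuppLE m w) :
    xMat n 𝕂 m c *ᵥ w = w := by
  ext a
  rw [mulVec, dotProduct, Finset.sum_eq_single a]
  · simp [xMat]
  · intro b _ hb
    by_cases hbm : (b : ℕ) = m
    · rw [hw b hbm.ge, mul_zero]
    · simp [xMat, hb.symm, hbm]
  · simp

theorem posProd_inv_succ_mulVec (d : ℕ → ℕ → 𝕂) {m : ℕ} (hm : m < n) {k : ℕ} (hk : k ≤ m + 1)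
    {w : Fin n → 𝕂} (hw : SuppLE m w) :
    (posProd n d k (m + 1))⁻¹ *ᵥ w = (posProd n d k m)⁻¹ *ᵥ w := by
  induction hk using Nat.decreasingInduction generalizing w with
  | self => rw [posProd_of_le n d le_rfl, posProd_of_le n d (by omega)]
  | of_succ k hk ih =>
    rw [posProd_inv, posRow_inv_succ n d (by omega) hm, posProd_inv n d k m, ← mulVec_mulVec,
      ← mulVec_mulVec, xMat_mulVec_of_suppLE n _ hw,
      ih ((isUpperUni_posRow n d k m).suppLE_inv hw), mulVec_mulVec]

theorem posProd_inv_succ_mulVec_last (d : ℕ → ℕ → 𝕂) {m : ℕ} (hm : m < n) {k : ℕ} (hk : k ≤ m) :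
    (posProd n d k (m + 1))⁻¹ *ᵥ stdVec n 𝕂 (m + 1) =
      (posProd n d (k + 1) (m + 1))⁻¹ *ᵥ stdVec n 𝕂 (m + 1) -
        d m k • ((posProd n d k m)⁻¹ *ᵥ stdVec n 𝕂 m) := by
  rw [posProd_inv, posRow_inv_succ n d hk hm, posProd_inv n d k m, ← mulVec_mulVec,
    ← mulVec_mulVec, xMat_mulVec_succ hm, mulVec_add, mulVec_smul,
    posRow_inv_mulVec_of_lt n d k hm.le (by omega), mulVec_add, mulVec_smul,
    posProd_inv_succ_mulVec n d hm (by omega)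
      ((isUpperUni_posRow n d k m).suppLE_inv (suppLE_stdVec le_rfl)), mulVec_mulVec, neg_smul,
    sub_eq_add_neg]

variable {n}

theorem negProd_mulVec_posProd_inv_last {τ d : ℕ → ℕ → 𝕂} (hτ0 : ∀ m, τ m 0 = 1)
    (hτ : ∀ m j, j < m → m ≤ n → τ m j ≠ 0)
    (hd : ∀ m k, k < m → m < n → d m (k + 1) = τ (m + 1) (k + 1) / τ m k)
    {m : ℕ} (hm : 1 ≤ m) (hmn : m ≤ n) {k : ℕ} (hk : k + 1 ≤ m) :
    negProd n τ m *ᵥ ((posProd n d (k + 1) m)⁻¹ *ᵥ stdVec n 𝕂 m) =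
      ((-1) ^ (m - (k + 1)) * τ m k) • stdVec n 𝕂 (k + 1) := by
  induction m, hm using Nat.le_induction generalizing k with
  | base =>
    obtain rfl : k = 0 := by omega
    simp [negProd, posProd, hτ0]
  | succ m hm ih =>
    induction Nat.le_of_succ_le_succ hk using Nat.decreasingInduction with
    | self =>
      rw [posProd_of_le n d le_rfl, inv_one, one_mulVec, negProd_succ n τ hm, ← mulVec_mulVec,
        negProd_mulVec_of_lt n τ hm (by omega), negRow_mulVec_last n _ (hτ0 _)]
      simp
    | of_succ k hkm ihk =>
      obtain ⟨j, rfl⟩ : ∃ j, m = k + 1 + j := ⟨m - (k + 1), by omega⟩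
      have h1 : τ (k + 1 + j) k ≠ 0 := hτ _ _ (by omega) (by omega)
      have h2 : τ (k + 1 + j + 1) (k + 1) ≠ 0 := hτ _ _ (by omega) (by omega)
      rw [posProd_inv_succ_mulVec_last n d (by omega) (by omega), mulVec_sub,
        ihk (by omega), mulVec_smul, negProd_succ n τ hm, ← mulVec_mulVec,
        ih (by omega) (by omega), mulVec_smul, negRow_mulVec n _ (hτ0 _) (by omega),
        hd _ _ (by omega) (by omega)]
      have e1 : k + 1 + j + 1 - (k + 1 + 1) = j := by omega
      have e2 : k + 1 + j - (k + 1) = j := by omega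
      have e3 : k + 1 + j + 1 - (k + 1) = j + 1 := by omega
      rw [e1, e2, e3]
      ext a
      simp only [Pi.sub_apply, Pi.add_apply, Pi.smul_apply, smul_eq_mul]
      field_simp
      ring

theorem suppLE_negProd_mulVec_posProd_inv {τ d : ℕ → ℕ → 𝕂} (hτ0 : ∀ m, τ m 0 = 1)
    (hτ : ∀ m j, j < m → m ≤ n → τ m j ≠ 0)
    (hd : ∀ m k, k < m → m < n → d m (k + 1) = τ (m + 1) (k + 1) / τ m k)
    {m : ℕ} (hm : 1 ≤ m) (hmn : m ≤ n) {j : ℕ} (hj : j ≤ m) :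
    SuppLE (m - j + 1) (negProd n τ m *ᵥ ((posProd n d 1 m)⁻¹ *ᵥ stdVec n 𝕂 j)) := by
  have last : ∀ m, 1 ≤ m → m ≤ n →
      SuppLE 1 (negProd n τ m *ᵥ ((posProd n d 1 m)⁻¹ *ᵥ stdVec n 𝕂 m)) := by
    intro m hm hmn a ha
    rw [negProd_mulVec_posProd_inv_last hτ0 hτ hd hm hmn (k := 0) (by omega), Pi.smul_apply,
      suppLE_stdVec le_rfl a ha, smul_zero]
  induction m, hm using Nat.le_induction with
  | base =>
    rcases Nat.le_one_iff_eq_zero_or_eq_one.1 hj with rfl | rfl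
    · rw [stdVec_eq_zero (.inl rfl), mulVec_zero, mulVec_zero]
      exact fun _ _ => rfl
    · simpa using last 1 le_rfl hmn
  | succ m hm ih =>
    rcases hj.eq_or_lt with rfl | hj
    · simpa using last (m + 1) (by omega) hmn
    · rw [posProd_inv_succ_mulVec n d (by omega) (by omega) (suppLE_stdVec (by omega)),
        negProd_succ n τ hm, ← mulVec_mulVec]
      have := suppLE_negRow_mulVec n (τ (m + 1)) (hτ0 _) m (ih (by omega) (by omega))
      rwa [show m - j + 1 + 1 = m + 1 - j + 1 by omega] at this

end Factor

section W0

variable {𝕂 : Type*} [Field 𝕂] {n : ℕ}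

theorem w0bar_mul_apply (A : Matrix (Fin n) (Fin n) 𝕂) (a b : Fin n) :
    (w0bar n 𝕂 * A) a b = (-1) ^ (n - 1 - (a : ℕ)) * A (Fin.rev a) b := by
  rw [mul_apply, Finset.sum_eq_single (Fin.rev a)]
  · rw [w0bar, if_pos (by rw [Fin.val_rev]; omega)]
  · intro c _ hc
    rw [w0bar, if_neg, zero_mul]
    intro h
    apply hc
    ext
    rw [Fin.val_rev]
    omega
  · simp

theorem w0bar_transpose : (w0bar n 𝕂)ᵀ = (-1 : 𝕂) ^ (n - 1) • w0bar n 𝕂 := by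
  ext a b
  simp only [transpose_apply, Matrix.smul_apply, smul_eq_mul, w0bar]
  by_cases h : (a : ℕ) + b = n - 1
  · rw [if_pos (by omega), if_pos h, ← h, show (a : ℕ) + b - b = a by omega,
      show (a : ℕ) + b - a = b by omega, pow_add, mul_assoc, ← pow_add, Even.neg_one_pow ⟨_, rfl⟩,
      mul_one]
  · rw [if_neg (by omega), if_neg h, mul_zero]

theorem w0bar_mul_self : w0bar n 𝕂 * w0bar n 𝕂 = (-1 : 𝕂) ^ (n - 1) • 1 := by
  ext a b
  rw [w0bar_mul_apply, Matrix.smul_apply, smul_eq_mul, w0bar, Fin.val_rev]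
  have := a.isLt
  have := b.isLt
  by_cases h : a = b
  · subst h
    rw [if_pos (by omega), ← pow_add, one_apply_eq, mul_one]
    congr 1
    omega
  · rw [one_apply_ne h, if_neg, mul_zero, mul_zero]
    rw [Fin.ext_iff] at h
    omega

theorem w0bar_inv : (w0bar n 𝕂)⁻¹ = (-1 : 𝕂) ^ (n - 1) • w0bar n 𝕂 := by
  apply inv_eq_right_inv
  rw [mul_smul_comm, w0bar_mul_self, smul_smul, ← pow_add, Even.neg_one_pow ⟨_, rfl⟩, one_smul]

theorem isUpperUni_w0bar_conj_transpose {U : Matrix (Fin n) (Fin n) 𝕂} (hU : IsUpperUni U) :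
    IsUpperUni (w0bar n 𝕂 * U * (w0bar n 𝕂)⁻¹)ᵀ := by
  have key : ∀ a b, (w0bar n 𝕂 * U * (w0bar n 𝕂)⁻¹)ᵀ a b =
      (-1) ^ (n - 1 - (a : ℕ)) * (-1) ^ (n - 1 - (b : ℕ)) * U (Fin.rev b) (Fin.rev a) := by
    intro a b
    have hw : (w0bar n 𝕂 * U * (w0bar n 𝕂)⁻¹)ᵀ = w0bar n 𝕂 * (w0bar n 𝕂 * U)ᵀ := by
      rw [transpose_mul, w0bar_inv, ← w0bar_transpose, transpose_transpose]
    rw [hw, w0bar_mul_apply, transpose_apply, w0bar_mul_apply, mul_assoc]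
  constructor
  · intro a b hab
    rw [key, hU.1 (i := Fin.rev b) (j := Fin.rev a) (Fin.rev_lt_rev.2 hab), mul_zero]
  · intro a
    rw [key, hU.2, mul_one, ← pow_add, Even.neg_one_pow ⟨_, rfl⟩]

/-- If `u = M P` with `P` upper unitriangular and `M` supported weakly above the antidiagonal,
then `P` is the matrix obtained from `u` by the twist. -/
theorem twist_eq_of_factorization {u L D U M P : Matrix (Fin n) (Fin n) 𝕂}
    (hL : ∀ a b : Fin n, a < b → L a b = 0) (hLdiag : ∀ a : Fin n, L a a = 1)
    (hD : ∀ a b : Fin n, a ≠ b → D a b = 0) (hDinv : ∀ a : Fin n, D a a ≠ 0)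
    (hU : IsUpperUni U) (hLDU : (w0bar n 𝕂 * uᵀ)⁻¹ = L * D * U)
    (hP : IsUpperUni P) (hM : ∀ a b : Fin n, n ≤ (a : ℕ) + b → M a b = 0) (hu : u = M * P) :
    (w0bar n 𝕂 * U⁻¹ * (w0bar n 𝕂)⁻¹)ᵀ = P := by
  set w := w0bar n 𝕂 with hw
  have hLu : IsUpperUni Lᵀ := ⟨fun a b hab => hL b a hab, hLdiag⟩
  have hDd : D = diagonal fun a => D a a := by
    ext a b
    by_cases h : a = b
    · subst h; simp
    · rw [hD a b h, diagonal_apply_ne _ h]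
  have hdet : (L * D * U).det ≠ 0 := by
    rw [det_mul, det_mul, ← det_transpose L, hLu.det, hU.det, one_mul, mul_one, hDd,
      det_diagonal]
    exact Finset.prod_ne_zero_iff.2 fun a _ => hDinv a
  have hA : IsUnit (w * uᵀ).det := by
    rw [← isUnit_nonsing_inv_det_iff, hLDU]
    exact hdet.isUnit
  have hAL : w * uᵀ * (L * D * U) = 1 := by rw [← hLDU, mul_nonsing_inv _ hA]
  have hUA : U * (w * uᵀ * L * D) = 1 := by
    rw [mul_eq_one_comm]
    simpa only [Matrix.mul_assoc] using hAL
  have hww : w * w⁻¹ = 1 := by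
    rw [hw, w0bar_inv, mul_smul_comm, w0bar_mul_self, smul_smul, ← pow_add,
      Even.neg_one_pow ⟨_, rfl⟩, one_smul]
  have hV := isUpperUni_w0bar_conj_transpose hU
  rw [← hw] at hV
  have hZ : P * (w * U * w⁻¹)ᵀ = 1 := by
    refine (hP.mul hV).eq_one_of_mul_eq_one (Y := wᵀ * (D * Lᵀ * M)) ?_ ?_
    · intro a b hab
      rw [hw, w0bar_transpose, smul_mul_assoc, Matrix.smul_apply, w0bar_mul_apply, mul_apply,
        Finset.sum_eq_zero, mul_zero, smul_zero]
      intro c _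
      by_cases hc : c < Fin.rev a
      · rw [hDd, diagonal_mul, transpose_apply, hL _ _ hc, mul_zero, zero_mul]
      · rw [hM, mul_zero]
        rw [Fin.lt_def, Fin.val_rev] at hc
        rw [Fin.lt_def] at hab
        omega
    · have hDt : Dᵀ = D := by rw [hDd, diagonal_transpose]
      have hwi : w⁻¹ = (-1 : 𝕂) ^ (n - 1) • w := w0bar_inv
      calc wᵀ * (D * Lᵀ * M) * (P * (w * U * w⁻¹)ᵀ)
          = wᵀ * (D * Lᵀ * (M * P)) * (w * U * w⁻¹)ᵀ := by simp only [Matrix.mul_assoc]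
        _ = (w * (U * (w⁻¹ * uᵀ * L * D)) * w)ᵀ := by
          rw [← hu]
          simp only [transpose_mul, transpose_transpose, hDt, Matrix.mul_assoc]
        _ = (w * w⁻¹)ᵀ := by
          rw [hwi]
          simp only [smul_mul_assoc, mul_smul_comm]
          rw [hUA, Matrix.mul_one]
        _ = 1 := by rw [hww, transpose_one]
  have hUU : U * U⁻¹ = 1 := mul_nonsing_inv _ (by simp [hU.det])
  have hww' : w⁻¹ * w = 1 := mul_eq_one_comm.1 hww
  have hVW : (w * U * w⁻¹)ᵀ * (w * U⁻¹ * w⁻¹)ᵀ = 1 := by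
    rw [← transpose_mul, mul_eq_one_comm.1]
    · exact transpose_one
    · calc w * U * w⁻¹ * (w * U⁻¹ * w⁻¹) = w * U * (w⁻¹ * w) * U⁻¹ * w⁻¹ := by
            simp only [Matrix.mul_assoc]
        _ = w * (U * U⁻¹) * w⁻¹ := by rw [hww', Matrix.mul_one]; simp only [Matrix.mul_assoc]
        _ = 1 := by rw [hUU, Matrix.mul_one, hww]
  calc (w * U⁻¹ * w⁻¹)ᵀ = P * (w * U * w⁻¹)ᵀ * (w * U⁻¹ * w⁻¹)ᵀ := by rw [hZ, Matrix.one_mul]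
    _ = P := by rw [Matrix.mul_assoc, hVW, Matrix.mul_one]

end W0

section Words

theorem sIdx_succ_succ (n q : ℕ) : sIdx n (q + 2) = sIdx n (q + 1) + (n - 1 - q) := by
  have : n - (q + 1) = n - 1 - q := by omega
  simp [sIdx, Finset.sum_Icc_succ_top, this]

theorem sIdx_succ_eq_sum_range (n q : ℕ) :
    sIdx n (q + 1) = ∑ i ∈ Finset.range q, (n - 1 - i) := by
  induction q with
  | zero => simp [sIdx]
  | succ q ih => rw [sIdx_succ_succ, ih, Finset.sum_range_succ]

theorem sIdx_self (n : ℕ) : sIdx n n = n * (n - 1) / 2 := by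
  rw [← Finset.sum_range_id, ← Finset.sum_range_reflect]
  cases n with
  | zero => simp [sIdx]
  | succ m => simp [sIdx_succ_eq_sum_range, Finset.sum_range_succ]

theorem sIdx_mono (n : ℕ) {k l : ℕ} (h : k ≤ l) : sIdx n k ≤ sIdx n l :=
  Finset.sum_le_sum_of_subset (Finset.Icc_subset_Icc_right (by omega))

theorem length_flatMap_word (n : ℕ) (g : ℕ → ℕ → ℕ) (q : ℕ) :
    ((List.range q).flatMap fun k => (List.range (n - 1 - k)).map (g k)).length =
      sIdx n (q + 1) := by
  induction q with
  | zero => simp [sIdx]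
  | succ q ih =>
    rw [List.range_succ, List.flatMap_append, List.length_append, ih, sIdx_succ_succ]
    simp

theorem prod_flatMap_word {R : Type*} [Monoid R] (n : ℕ) (g : ℕ → ℕ → ℕ) (f : ℕ → ℕ → R)
    (q : ℕ) :
    ((List.range (sIdx n (q + 1))).map fun t =>
      f (((List.range q).flatMap fun k => (List.range (n - 1 - k)).map (g k)).getD t 0) t).prod =
    ((List.range q).map fun k =>
      ((List.range (n - 1 - k)).map fun a => f (g k a) (sIdx n (k + 1) + a)).prod).prod := by
  induction q with
  | zero => simp [sIdx]
  | succ q ih =>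
    have hl := length_flatMap_word n g q
    rw [List.range_succ (n := q), List.flatMap_append, List.map_append, List.prod_append, ← ih,
      sIdx_succ_succ, List.range_add, List.map_append, List.prod_append, List.map_map]
    congr 1
    · congr 1
      refine List.map_congr_left fun t ht => ?_
      rw [List.getD_append _ _ _ _ (by rw [hl]; exact List.mem_range.1 ht)]
    · simp only [List.flatMap_cons, List.flatMap_nil, List.append_nil, List.map_cons,
        List.map_nil, List.prod_cons, List.prod_nil, mul_one]
      congr 1
      refine List.map_congr_left fun t ht => ?_
      rw [Function.comp_apply, List.getD_append_right _ _ _ _ (by rw [hl]; omega), hl,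
        Nat.add_sub_cancel_left]
      rw [List.mem_range] at ht
      simp [ht]

end Words

/-- the twisted matrix u₁ factorises along the word 𝐢′₀ as
u₁ = x_{i′_1}(p_1)⋯x_{i′_N}(p_N) with the p's the explicit monomials in the z's. -/
theorem stmt7
    (𝕂 : Type*) [Field 𝕂]
    (n N : ℕ) (hn : 2 ≤ n) (hN : N = n * (n - 1) / 2)
    (z : ℕ → 𝕂) (hz : ∀ j, 1 ≤ j → j ≤ N → z j ≠ 0)
    (u : Matrix (Fin n) (Fin n) 𝕂)
    (hu : u = ((List.range N).map
      (fun t => xNegMat n 𝕂 ((wordI0 n).getD t 0) (z (t + 1)))).prod)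
    (L D U : Matrix (Fin n) (Fin n) 𝕂)
    (hL : ∀ a b : Fin n, a < b → L a b = 0) (hLdiag : ∀ a : Fin n, L a a = 1)
    (hD : ∀ a b : Fin n, a ≠ b → D a b = 0) (hDinv : ∀ a : Fin n, D a a ≠ 0)
    (hU : ∀ a b : Fin n, b < a → U a b = 0) (hUdiag : ∀ a : Fin n, U a a = 1)
    (hLDU : (w0bar n 𝕂 * u.transpose)⁻¹ = L * D * U)
    (u₁ : Matrix (Fin n) (Fin n) 𝕂)
    (hu₁ : u₁ = (w0bar n 𝕂 * U⁻¹ * (w0bar n 𝕂)⁻¹).transpose)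
    (p : ℕ → 𝕂)
    (hp : ∀ k a, 1 ≤ k → k ≤ n - 1 → 1 ≤ a → a ≤ n - k →
      p (sIdx n k + a) =
        if k = 1 then z (1 + sIdx n a)
        else z (k + sIdx n a) / z (k - 1 + sIdx n (a + 1))) :
    u₁ = ((List.range N).map
      (fun t => xMat n 𝕂 ((wordI0' n).getD t 0) (p (t + 1)))).prod := by
  obtain ⟨τ, hτ⟩ : ∃ τ : ℕ → ℕ → 𝕂, τ = fun m j =>
    if j = 0 then 1 else z (j + sIdx n (n - m + 1)) := ⟨_, rfl⟩
  obtain ⟨d, hd⟩ : ∃ d : ℕ → ℕ → 𝕂, d = fun i k => τ (i + 1) k / τ i (k - 1) := ⟨_, rfl⟩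
  have hτ0 : ∀ m, τ m 0 = 1 := by simp [hτ]
  have hNs : N = sIdx n (n - 1 + 1) := by rw [hN, Nat.sub_add_cancel (by omega), sIdx_self]
  have hτne : ∀ m j, j < m → m ≤ n → τ m j ≠ 0 := by
    intro m j hj hm
    simp only [hτ]
    split_ifs with h0
    · exact one_ne_zero
    · refine hz _ (by omega) ?_
      have h1 := sIdx_succ_succ n (n - m)
      have h2 := sIdx_mono n (show n - m + 2 ≤ n - 1 + 1 by omega)
      omega
  have hdτ : ∀ m k, k < m → m < n → d m (k + 1) = τ (m + 1) (k + 1) / τ m k := by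
    simp [hd]
  have huN : u = negProd n τ n := by
    rw [hu, hNs, wordI0]
    refine (prod_flatMap_word n (fun _ a => a + 1) (fun i t => xNegMat n 𝕂 i (z (t + 1)))
      (n - 1)).trans ?_
    rw [negProd]
    congr 1
    refine List.map_congr_left fun k hk => ?_
    rw [List.mem_range] at hk
    rw [negRow, show n - k - 1 = n - 1 - k by omega]
    congr 1
    refine List.map_congr_left fun a ha => ?_
    have e1 : n - (n - k) + 1 = k + 1 := by omega
    have e2 : sIdx n (k + 1) + a + 1 = a + 1 + sIdx n (k + 1) := by omega
    simp [hτ, e1, e2]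
  have hP : ((List.range N).map
      (fun t => xMat n 𝕂 ((wordI0' n).getD t 0) (p (t + 1)))).prod = posProd n d 1 n := by
    rw [hNs, wordI0']
    refine (prod_flatMap_word n (fun _ a => n - 1 - a) (fun i t => xMat n 𝕂 i (p (t + 1)))
      (n - 1)).trans ?_
    rw [posProd]
    congr 1
    refine List.map_congr_left fun k hk => ?_
    rw [List.mem_range] at hk
    rw [posRow, show n - (1 + k) = n - 1 - k by omega]
    congr 1
    refine List.map_congr_left fun a ha => ?_
    rw [List.mem_range] at ha
    congr 1
    rw [Nat.add_assoc, hp (k + 1) (a + 1) (by omega) (by omega) (by omega) (by omega)]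
    have e1 : n - (n - 1 - a + 1) + 1 = a + 1 := by omega
    have e2 : n - (n - 1 - a) + 1 = a + 1 + 1 := by omega
    simp only [hd, hτ, e1, e2]
    rcases k with _ | k
    · simp
    · simp [Nat.add_comm 1]
  rw [hu₁, hP]
  have hPu := isUpperUni_posProd n d 1 n
  refine twist_eq_of_factorization hL hLdiag hD hDinv ⟨fun a b h => hU a b h, hUdiag⟩
    hLDU hPu (M := u * (posProd n d 1 n)⁻¹) ?_ ?_
  · intro a b hab
    have h := suppLE_negProd_mulVec_posProd_inv hτ0 hτne hdτ (by omega) le_rfl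
      (show (b : ℕ) + 1 ≤ n by omega) a (by omega)
    rwa [mulVec_mulVec, mulVec_stdVec, ← huN] at h
  · rw [nonsing_inv_mul_cancel_right _ _ (by simp [hPu.det])]
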